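/- arXiv:2201.03774 — 4 statements merged into one kernel-verified Lean document; each statement's English description precedes it below -/
import Mathlib

section
/- Let H : ℝⁿ × ℝ × ℝⁿ → ℝ be a C¹ time-dependent Hamiltonian whose partial derivatives ∂H/∂q and ∂H/∂p are locally Lipschitz, and let g : ℝⁿ × ℝ × ℝⁿ → ℝ be C¹. Suppose (Q,𝔮,P,𝔭) : [0,T̄] → ℝⁿ × ℝ × ℝⁿ × ℝ satisfies the extended Hamilton's equations for the Poincaré transformed Hamiltonian H̄(q,𝔮,p,𝔭) = g(q,𝔮,p)(H(q,𝔮,p) + 𝔭) with 𝔭(0) = −H(Q(0),𝔮(0),P(0)). Suppose also that (q,p) : I → ℝⁿ × ℝⁿ, defined on an interval I containing 𝔮(τ) for all τ ∈ [0,T̄], satisfies the original Hamilton's equations q̇(t) = ∂H/∂p(q(t),t,p(t)), ṗ(t) = −∂H/∂q(q(t),t,p(t)) with q(𝔮(0)) = Q(0) and p(𝔮(0)) = P(0). Then Q(τ) = q(𝔮(τ)) and P(τ) = p(𝔮(τ)) for all τ ∈ [0,T̄]; that is, the (q,p)-components of the extended flow are a time reparametrization of the original Hamiltonian flow, with physical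 time t = 𝔮(τ) evolving according to dt/dτ = g. -/
open Set

section Slices

variable {E F : Type*} [NormedAddCommGroup E] [NormedSpace ℝ E]
  [NormedAddCommGroup F] [NormedSpace ℝ F]

lemma fderiv_slice_fst {f : E × ℝ × F → ℝ} {f' : E × ℝ × F →L[ℝ] ℝ} {a : E} {b : ℝ} {c : F}
    (hf : HasFDerivAt f f' (a, b, c)) (v : E) :
    fderiv ℝ (fun x => f (x, b, c)) a v = f' (v, 0, 0) := by
  have h := HasFDerivAt.comp (f := fun x => (x, b, c)) a hf
    ((hasFDerivAt_id a).prodMk (hasFDerivAt_const (b, c) a))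
  exact congrArg (fun L => L v) h.fderiv

lemma deriv_slice_mid {f : E × ℝ × F → ℝ} {f' : E × ℝ × F →L[ℝ] ℝ} {a : E} {b : ℝ} {c : F}
    (hf : HasFDerivAt f f' (a, b, c)) :
    deriv (fun x => f (a, x, c)) b = f' (0, 1, 0) :=
  (hf.comp_hasDerivAt b
    ((hasDerivAt_const b a).prodMk ((hasDerivAt_id b).prodMk (hasDerivAt_const b c)))).deriv

lemma fderiv_slice_snd {f : E × ℝ × F → ℝ} {f' : E × ℝ × F →L[ℝ] ℝ} {a : E} {b : ℝ} {c : F}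
    (hf : HasFDerivAt f f' (a, b, c)) (v : F) :
    fderiv ℝ (fun x => f (a, b, x)) c v = f' (0, 0, v) := by
  have h := HasFDerivAt.comp (f := fun x => (a, b, x)) c hf
    ((hasFDerivAt_const a c).prodMk ((hasFDerivAt_const b c).prodMk (hasFDerivAt_id c)))
  exact congrArg (fun L => L v) h.fderiv

end Slices

/-- A functional on `ℝⁿ × ℝ × ℝⁿ` is determined by its values on the coordinate vectors. -/
lemma ContinuousLinearMap.apply_pi_prod_eq_sum {n : ℕ}
    (L : (Fin n → ℝ) × ℝ × (Fin n → ℝ) →L[ℝ] ℝ) (u : Fin n → ℝ) (r : ℝ) (v : Fin n → ℝ) :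
    L (u, r, v) = ∑ i, u i * L (Pi.single i 1, 0, 0) + r * L (0, 1, 0)
      + ∑ i, v i * L (0, 0, Pi.single i 1) := by
  have single_eq (i : Fin n) : (fun j => if i = j then (1 : ℝ) else 0) = Pi.single i 1 := by
    ext j
    simp [Pi.single_apply, eq_comm]
  have hu : L (u, 0, 0) = ∑ i, u i * L (Pi.single i 1, 0, 0) := by
    simpa [single_eq, Prod.zero_eq_mk] using
      (L.comp (.inl ℝ (Fin n → ℝ) (ℝ × (Fin n → ℝ)))).toLinearMap.pi_apply_eq_sum_univ u
  have hv : L (0, 0, v) = ∑ i, v i * L (0, 0, Pi.single i 1) := by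
    simpa [single_eq] using
      (L.comp ((ContinuousLinearMap.inr ℝ (Fin n → ℝ) (ℝ × (Fin n → ℝ))).comp
      (.inr ℝ ℝ (Fin n → ℝ)))).toLinearMap.pi_apply_eq_sum_univ v
  have hr : L (0, r, 0) = r * L (0, 1, 0) := by
    rw [← smul_eq_mul, ← map_smul]; simp
  rw [← hu, ← hv, ← hr, ← map_add, ← map_add]
  simp

section ODE

variable {V : Type*} [NormedAddCommGroup V] [NormedSpace ℝ V] {a b : ℝ}

/-- Uniqueness for `x' = γ(τ) Φ(x)` with `γ` continuous and `Φ` locally Lipschitz. -/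
lemma eqOn_Icc_of_hasDerivAt_smul_locallyLipschitz {Φ : V → V} (hΦ : LocallyLipschitz Φ)
    {γ : ℝ → ℝ} (hγ : ContinuousOn γ (Icc a b)) {x y : ℝ → V}
    (hx : ∀ τ ∈ Icc a b, HasDerivAt x (γ τ • Φ (x τ)) τ)
    (hy : ∀ τ ∈ Icc a b, HasDerivAt y (γ τ • Φ (y τ)) τ) (hxy : x a = y a) :
    EqOn x y (Icc a b) := by
  have hxc : ContinuousOn x (Icc a b) := HasDerivAt.continuousOn hx
  have hyc : ContinuousOn y (Icc a b) := HasDerivAt.continuousOn hy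
  obtain ⟨K, hK⟩ := (hΦ.locallyLipschitzOn (s := x '' Icc a b ∪ y '' Icc a b)
    ).exists_lipschitzOnWith_of_compact
    ((isCompact_Icc.image_of_continuousOn hxc).union (isCompact_Icc.image_of_continuousOn hyc))
  obtain ⟨C, hC⟩ := isCompact_Icc.exists_bound_of_continuousOn hγ
  have hzero := eq_zero_of_abs_deriv_le_mul_abs_self_of_eq_zero_right (K := C * K)
    (f := fun τ => x τ - y τ) (f' := fun τ => γ τ • Φ (x τ) - γ τ • Φ (y τ))
    (hxc.sub hyc)
    (fun τ hτ => ((hx τ (Ico_subset_Icc_self hτ)).sub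
      (hy τ (Ico_subset_Icc_self hτ))).hasDerivWithinAt)
    (sub_eq_zero.2 hxy) fun τ hτ => by
      have hτ' := Ico_subset_Icc_self hτ
      rw [← smul_sub, norm_smul, mul_assoc]
      exact mul_le_mul (hC τ hτ')
        (hK.norm_sub_le (.inl (mem_image_of_mem x hτ')) (.inr (mem_image_of_mem y hτ')))
        (norm_nonneg _) ((norm_nonneg _).trans (hC τ hτ'))
  exact fun τ hτ => sub_eq_zero.1 (hzero τ hτ)

/-- A solution of `x' = k(τ) x` with `k` continuous that starts at zero vanishes. -/
lemma eq_zero_of_hasDerivAt_smul_self {k : ℝ → ℝ} (hk : ContinuousOn k (Icc a b)) {x : ℝ → V}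
    (hx : ∀ τ ∈ Icc a b, HasDerivAt x (k τ • x τ) τ) (ha : x a = 0) :
    ∀ τ ∈ Icc a b, x τ = 0 :=
  eqOn_Icc_of_hasDerivAt_smul_locallyLipschitz LocallyLipschitz.id hk hx
    (y := fun _ => 0) (fun τ _ => by simpa using hasDerivAt_const τ (0 : V)) ha

end ODE

/-- Suppose `H` is a C¹ time-dependent Hamiltonian with locally Lipschitz partial derivatives
`∂H/∂q`, `∂H/∂p`, and `g` is C¹.  If `(Q,𝔮,P,𝔭)` satisfies the extended Hamilton's equations
for the Poincaré transformed Hamiltonian `H̄(q,𝔮,p,𝔭) = g(q,𝔮,p)(H(q,𝔮,p) + 𝔭)` with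
`𝔭(0) = −H(Q(0),𝔮(0),P(0))`, and `(q,p)`, defined on an interval `I` containing `𝔮(τ)` for all
`τ ∈ [0,T̄]`, satisfies the original Hamilton's equations with `q(𝔮(0)) = Q(0)`,
`p(𝔮(0)) = P(0)`, then `Q(τ) = q(𝔮(τ))` and `P(τ) = p(𝔮(τ))` for all `τ ∈ [0,T̄]`. -/
theorem poincare_flow_is_time_reparametrization {n : ℕ} (T' : ℝ) (hT' : 0 ≤ T')
    (H g : (Fin n → ℝ) → ℝ → (Fin n → ℝ) → ℝ)
    (hH : ContDiff ℝ 1 fun x : (Fin n → ℝ) × ℝ × (Fin n → ℝ) => H x.1 x.2.1 x.2.2)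
    (hg : ContDiff ℝ 1 fun x : (Fin n → ℝ) × ℝ × (Fin n → ℝ) => g x.1 x.2.1 x.2.2)
    (hHq_lip : LocallyLipschitz fun x : (Fin n → ℝ) × ℝ × (Fin n → ℝ) =>
      (fun i => fderiv ℝ (fun a => H a x.2.1 x.2.2) x.1 (Pi.single i 1) : Fin n → ℝ))
    (hHp_lip : LocallyLipschitz fun x : (Fin n → ℝ) × ℝ × (Fin n → ℝ) =>
      (fun i => fderiv ℝ (fun c => H x.1 x.2.1 c) x.2.2 (Pi.single i 1) : Fin n → ℝ))
    (Hbar : (Fin n → ℝ) → ℝ → (Fin n → ℝ) → ℝ → ℝ)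
    (hHbar : ∀ a b c e, Hbar a b c e = g a b c * (H a b c + e))
    (Q P : ℝ → Fin n → ℝ) (𝔮 𝔭 : ℝ → ℝ)
    (heq_Q : ∀ τ ∈ Set.Icc (0 : ℝ) T', ∀ i,
      HasDerivAt (fun s => Q s i)
        (fderiv ℝ (fun c => Hbar (Q τ) (𝔮 τ) c (𝔭 τ)) (P τ) (Pi.single i 1)) τ)
    (heq_𝔮 : ∀ τ ∈ Set.Icc (0 : ℝ) T',
      HasDerivAt 𝔮 (deriv (fun e => Hbar (Q τ) (𝔮 τ) (P τ) e) (𝔭 τ)) τ)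
    (heq_P : ∀ τ ∈ Set.Icc (0 : ℝ) T', ∀ i,
      HasDerivAt (fun s => P s i)
        (-(fderiv ℝ (fun a => Hbar a (𝔮 τ) (P τ) (𝔭 τ)) (Q τ) (Pi.single i 1))) τ)
    (heq_𝔭 : ∀ τ ∈ Set.Icc (0 : ℝ) T',
      HasDerivAt 𝔭 (-(deriv (fun b => Hbar (Q τ) b (P τ) (𝔭 τ)) (𝔮 τ))) τ)
    (hinit : 𝔭 0 = -(H (Q 0) (𝔮 0) (P 0)))
    (I : Set ℝ) (hI : I.OrdConnected) (hmem : ∀ τ ∈ Set.Icc (0 : ℝ) T', 𝔮 τ ∈ I)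
    (q p : ℝ → Fin n → ℝ)
    (heq_q : ∀ t ∈ I, ∀ i,
      HasDerivAt (fun s => q s i)
        (fderiv ℝ (fun c => H (q t) t c) (p t) (Pi.single i 1)) t)
    (heq_p : ∀ t ∈ I, ∀ i,
      HasDerivAt (fun s => p s i)
        (-(fderiv ℝ (fun a => H a t (p t)) (q t) (Pi.single i 1))) t)
    (hq0 : q (𝔮 0) = Q 0) (hp0 : p (𝔮 0) = P 0) :
    ∀ τ ∈ Set.Icc (0 : ℝ) T', Q τ = q (𝔮 τ) ∧ P τ = p (𝔮 τ) := by
  set h : (Fin n → ℝ) × ℝ × (Fin n → ℝ) → ℝ := fun x => H x.1 x.2.1 x.2.2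
  set G : (Fin n → ℝ) × ℝ × (Fin n → ℝ) → ℝ := fun x => g x.1 x.2.1 x.2.2
  set z : ℝ → (Fin n → ℝ) × ℝ × (Fin n → ℝ) := fun τ => (Q τ, 𝔮 τ, P τ) with hz
  have hh' (x) : HasFDerivAt h (fderiv ℝ h x) x := (hH.differentiable one_ne_zero x).hasFDerivAt
  have hG' (x) : HasFDerivAt G (fderiv ℝ G x) x := (hg.differentiable one_ne_zero x).hasFDerivAt
  set ε : ℝ → ℝ := fun τ => h (z τ) + 𝔭 τ with hε
  have hK (τ) : HasFDerivAt (fun x => G x * (h x + 𝔭 τ))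
      (G (z τ) • fderiv ℝ h (z τ) + ε τ • fderiv ℝ G (z τ)) (Q τ, 𝔮 τ, P τ) :=
    (hG' (z τ)).mul ((hh' (z τ)).add_const (𝔭 τ))
  simp only [hHbar] at heq_Q heq_𝔮 heq_P heq_𝔭
  have hQ : ∀ τ ∈ Icc 0 T', HasDerivAt Q (fun i => G (z τ) * fderiv ℝ h (z τ) (0, 0, Pi.single i 1)
      + ε τ * fderiv ℝ G (z τ) (0, 0, Pi.single i 1)) τ := fun τ hτ =>
    hasDerivAt_pi.2 fun i => (heq_Q τ hτ i).congr_deriv (fderiv_slice_snd (hK τ) _)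
  have hP : ∀ τ ∈ Icc 0 T', HasDerivAt P (fun i => -(G (z τ) *
      fderiv ℝ h (z τ) (Pi.single i 1, 0, 0) + ε τ * fderiv ℝ G (z τ) (Pi.single i 1, 0, 0))) τ :=
    fun τ hτ => hasDerivAt_pi.2 fun i =>
      (heq_P τ hτ i).congr_deriv (congrArg Neg.neg (fderiv_slice_fst (hK τ) _))
  have h𝔮 : ∀ τ ∈ Icc 0 T', HasDerivAt 𝔮 (G (z τ)) τ := fun τ hτ =>
    (heq_𝔮 τ hτ).congr_deriv (by simp [G, hz])
  have h𝔭 : ∀ τ ∈ Icc 0 T', HasDerivAt 𝔭 (-(G (z τ) * fderiv ℝ h (z τ) (0, 1, 0)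
      + ε τ * fderiv ℝ G (z τ) (0, 1, 0))) τ := fun τ hτ =>
    (heq_𝔭 τ hτ).congr_deriv (congrArg Neg.neg (deriv_slice_mid (hK τ)))
  have hz' (τ) (hτ : τ ∈ Icc 0 T') := (hQ τ hτ).prodMk ((h𝔮 τ hτ).prodMk (hP τ hτ))
  have hzc : ContinuousOn z (Icc 0 T') := HasDerivAt.continuousOn hz'
  have hhc : ContinuousOn (fun τ => fderiv ℝ h (z τ)) (Icc 0 T') :=
    (hH.continuous_fderiv one_ne_zero).comp_continuousOn hzc
  have hGc : ContinuousOn (fun τ => fderiv ℝ G (z τ)) (Icc 0 T') :=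
    (hg.continuous_fderiv one_ne_zero).comp_continuousOn hzc
  have hε0 : ∀ τ ∈ Icc 0 T', ε τ = 0 := by
    refine eq_zero_of_hasDerivAt_smul_self (k := fun τ =>
      ∑ i, (fderiv ℝ h (z τ) (Pi.single i 1, 0, 0) * fderiv ℝ G (z τ) (0, 0, Pi.single i 1)
        - fderiv ℝ h (z τ) (0, 0, Pi.single i 1) * fderiv ℝ G (z τ) (Pi.single i 1, 0, 0))
      - fderiv ℝ G (z τ) (0, 1, 0)) (by fun_prop) (fun τ hτ => ?_) ?_
    · refine (((hh' (z τ)).comp_hasDerivAt τ (hz' τ hτ)).add (h𝔭 τ hτ)).congr_deriv ?_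
      rw [ContinuousLinearMap.apply_pi_prod_eq_sum, smul_eq_mul, sub_mul, Finset.sum_mul,
        add_right_comm (∑ i, _), ← Finset.sum_add_distrib, add_assoc, sub_eq_add_neg]
      congr 1
      · exact Finset.sum_congr rfl fun i _ => by ring
      · ring
    · simp [hε, hz, h, hinit]
  have hΦ : LocallyLipschitz fun x : (Fin n → ℝ) × ℝ × (Fin n → ℝ) =>
      ((fun i => fderiv ℝ (fun c => H x.1 x.2.1 c) x.2.2 (Pi.single i 1) : Fin n → ℝ), (1 : ℝ),
        -(fun i => fderiv ℝ (fun a => H a x.2.1 x.2.2) x.1 (Pi.single i 1) : Fin n → ℝ)) :=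
    hHp_lip.prodMk ((LocallyLipschitz.const 1).prodMk hHq_lip.neg)
  have key := eqOn_Icc_of_hasDerivAt_smul_locallyLipschitz hΦ (γ := fun τ => G (z τ))
    (hg.continuous.comp_continuousOn hzc) (x := z) (y := fun τ => (q (𝔮 τ), 𝔮 τ, p (𝔮 τ)))
    (fun τ hτ => (hz' τ hτ).congr_deriv ?_) (fun τ hτ => ?_) (by simp [hz, hq0, hp0])
  · intro τ hτ
    have := key hτ
    simp only [hz, Prod.mk.injEq, true_and] at this
    exact this
  · ext i
    · simp [hε0 τ hτ, hz, ← fderiv_slice_snd (hh' (Q τ, 𝔮 τ, P τ)), h]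
    · simp
    · simp [hε0 τ hτ, hz, ← fderiv_slice_fst (hh' (Q τ, 𝔮 τ, P τ)), h]
  · have hq := (hasDerivAt_pi.2 (heq_q _ (hmem τ hτ))).scomp τ (h𝔮 τ hτ)
    have hp := (hasDerivAt_pi.2 (heq_p _ (hmem τ hτ))).scomp τ (h𝔮 τ hτ)
    refine (hq.prodMk ((h𝔮 τ hτ).prodMk hp)).congr_deriv ?_
    ext i <;> simp
end

section
/- Let H : ℝⁿ × ℝ × ℝⁿ → ℝ and g : ℝⁿ × ℝ × ℝⁿ → ℝ be C¹, and define the extended action functional on C¹ curves (q,𝔮,p,𝔭) : [0,T̄] → ℝⁿ × ℝ × ℝⁿ × ℝ by 𝔖 = p(T̄)ᵀq(T̄) + 𝔭(T̄)𝔮(T̄) − ∫₀^{T̄} { pᵀq' + 𝔭𝔮' − g(q,𝔮,p)[H(q,𝔮,p) + 𝔭] } dτ. Then a C¹ curve (q,𝔮,p,𝔭) with continuous derivative makes 𝔖 stationary — i.e., for every C¹ variation (δq,δ𝔮,δp,δ𝔭) with (δq,δ𝔮)(0) = 0 and (δp,δ𝔭)(T̄) = 0, the derivative (d/dε)|_{ε=0}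 𝔖((q,𝔮,p,𝔭) + ε(δq,δ𝔮,δp,δ𝔭)) vanishes — if and only if the curve satisfies the extended Hamilton's equations: 𝔮' = g, q' = g ∂H/∂p + (∂g/∂p)(H + 𝔭), p' = −g ∂H/∂q − (∂g/∂q)(H + 𝔭), 𝔭' = −g ∂H/∂𝔮 − (∂g/∂𝔮)(H + 𝔭), where all functions are evaluated at (q(τ),𝔮(τ),p(τ)). -/
open MeasureTheory Set Filter Topology

/-- Differentiation under the integral sign for jointly continuous integrands. -/
lemma hasDerivAt_intervalIntegral_of_continuous {F F' : ℝ → ℝ → ℝ} {a b x₀ : ℝ}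
    (hF : ∀ x, Continuous (F x)) (hF' : Continuous fun z : ℝ × ℝ => F' z.1 z.2)
    (hd : ∀ x t, HasDerivAt (fun y => F y t) (F' x t) x) :
    HasDerivAt (fun x => ∫ t in a..b, F x t) (∫ t in a..b, F' x₀ t) x₀ := by
  obtain ⟨C, hC⟩ := ((isCompact_closedBall x₀ 1).prod (isCompact_uIcc (a := a) (b := b))
    ).exists_bound_of_continuousOn hF'.continuousOn
  refine (intervalIntegral.hasDerivAt_integral_of_dominated_loc_of_deriv_le
    (bound := fun _ => C) (Metric.closedBall_mem_nhds x₀ one_pos)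
    (Eventually.of_forall fun x => (hF x).aestronglyMeasurable)
    ((hF x₀).intervalIntegrable _ _)
    (by fun_prop : Continuous (F' x₀)).aestronglyMeasurable
    (Eventually.of_forall fun t ht x hx => hC (x, t) ⟨hx, uIoc_subset_uIcc ht⟩)
    intervalIntegrable_const (Eventually.of_forall fun t _ x _ => hd x t)).2

/-- The fundamental lemma of the calculus of variations on a compact interval. -/
lemma eqOn_zero_of_intervalIntegral_mul_eq_zero {f : ℝ → ℝ} {a b : ℝ} (hab : a < b)
    (hf : Continuous f)
    (h : ∀ φ : ℝ → ℝ, ContDiff ℝ 1 φ → φ a = 0 → φ b = 0 → ∫ t in a..b, φ t * f t = 0) :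
    ∀ t ∈ Icc a b, f t = 0 := by
  have hae : ∀ᵐ t, t ∈ Ioo a b → f t = 0 := by
    refine isOpen_Ioo.ae_eq_zero_of_integral_contDiff_smul_eq_zero
      (hf.locallyIntegrable.locallyIntegrableOn _) fun φ hφ _ hsupp => ?_
    have hout : ∀ t, t ∉ Ioo a b → φ t = 0 := fun t ht =>
      image_eq_zero_of_notMem_tsupport fun h' => ht (hsupp h')
    have := h φ (hφ.of_le (by exact_mod_cast le_top)) (hout a (by simp)) (hout b (by simp))
    rw [intervalIntegral.integral_of_le hab.le, integral_Ioc_eq_integral_Ioo] at this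
    rw [← this, setIntegral_eq_integral_of_forall_compl_eq_zero]
    · simp
    · intro t ht
      simp [hout t ht]
  refine Measure.eqOn_Icc_of_ae_eq volume hab.ne (g := fun _ => 0) ?_ hf.continuousOn
    continuousOn_const
  rw [Measure.restrict_congr_set Ioo_ae_eq_Icc.symm]
  exact (ae_restrict_iff' measurableSet_Ioo).2 hae

/-- The partial derivative in the first argument in terms of the total derivative. -/
lemma fderiv_fst_eq {n : ℕ} {f : (Fin n → ℝ) → ℝ → (Fin n → ℝ) → ℝ}
    (hf : ContDiff ℝ 1 fun x : (Fin n → ℝ) × ℝ × (Fin n → ℝ) => f x.1 x.2.1 x.2.2)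
    (a : Fin n → ℝ) (b : ℝ) (c u : Fin n → ℝ) :
    fderiv ℝ (fun x => f x b c) a u =
      fderiv ℝ (fun x : (Fin n → ℝ) × ℝ × (Fin n → ℝ) => f x.1 x.2.1 x.2.2) (a, b, c)
        (u, 0, 0) := by
  have h := ((hf.differentiable one_ne_zero) (a, b, c)).hasFDerivAt
  have h2 : HasFDerivAt (fun x : Fin n → ℝ => (x, b, c))
      ((ContinuousLinearMap.id ℝ _).prod 0) a :=
    (hasFDerivAt_id a).prodMk (hasFDerivAt_const (b, c) a)
  have h3 := (HasFDerivAt.comp (f := fun x : Fin n → ℝ => (x, b, c)) a h h2).fderiv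
  exact congrArg (fun L => L u) h3

/-- The partial derivative in the second argument in terms of the total derivative. -/
lemma deriv_snd_eq {n : ℕ} {f : (Fin n → ℝ) → ℝ → (Fin n → ℝ) → ℝ}
    (hf : ContDiff ℝ 1 fun x : (Fin n → ℝ) × ℝ × (Fin n → ℝ) => f x.1 x.2.1 x.2.2)
    (a : Fin n → ℝ) (b : ℝ) (c : Fin n → ℝ) :
    deriv (fun x => f a x c) b =
      fderiv ℝ (fun x : (Fin n → ℝ) × ℝ × (Fin n → ℝ) => f x.1 x.2.1 x.2.2) (a, b, c)
        (0, 1, 0) := by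
  have h := ((hf.differentiable one_ne_zero) (a, b, c)).hasFDerivAt
  have h2 : HasDerivAt (fun x : ℝ => (a, x, c)) (0, 1, 0) b :=
    (hasDerivAt_const b a).prodMk ((hasDerivAt_id b).prodMk (hasDerivAt_const b c))
  exact (h.comp_hasDerivAt b h2).deriv

/-- The partial derivative in the third argument in terms of the total derivative. -/
lemma fderiv_trd_eq {n : ℕ} {f : (Fin n → ℝ) → ℝ → (Fin n → ℝ) → ℝ}
    (hf : ContDiff ℝ 1 fun x : (Fin n → ℝ) × ℝ × (Fin n → ℝ) => f x.1 x.2.1 x.2.2)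
    (a : Fin n → ℝ) (b : ℝ) (c u : Fin n → ℝ) :
    fderiv ℝ (fun x => f a b x) c u =
      fderiv ℝ (fun x : (Fin n → ℝ) × ℝ × (Fin n → ℝ) => f x.1 x.2.1 x.2.2) (a, b, c)
        (0, 0, u) := by
  have h := ((hf.differentiable one_ne_zero) (a, b, c)).hasFDerivAt
  have h2 : HasFDerivAt (fun x : Fin n → ℝ => (a, b, x))
      (ContinuousLinearMap.prod 0 (ContinuousLinearMap.prod 0 (ContinuousLinearMap.id ℝ _))) c :=
    (hasFDerivAt_const a c).prodMk ((hasFDerivAt_const b c).prodMk (hasFDerivAt_id c))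
  have h3 := (HasFDerivAt.comp (f := fun x : Fin n → ℝ => (a, b, x)) c h h2).fderiv
  exact congrArg (fun L => L u) h3

/-- A linear form on `ℝⁿ × ℝ × ℝⁿ` expanded in the standard basis. -/
lemma clm_apply_prod_eq_sum {n : ℕ} (L : (Fin n → ℝ) × ℝ × (Fin n → ℝ) →L[ℝ] ℝ)
    (u : Fin n → ℝ) (v : ℝ) (w : Fin n → ℝ) :
    L (u, v, w) = (∑ i, u i * L (Pi.single i 1, 0, 0)) + v * L (0, 1, 0)
      + ∑ i, w i * L (0, 0, Pi.single i 1) := by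
  have hvec : (u, v, w) = (∑ i, u i • ((Pi.single i 1, 0, 0) : (Fin n → ℝ) × ℝ × (Fin n → ℝ)))
      + v • ((0, 1, 0) : (Fin n → ℝ) × ℝ × (Fin n → ℝ))
      + ∑ i, w i • ((0, 0, Pi.single i 1) : (Fin n → ℝ) × ℝ × (Fin n → ℝ)) := by
    ext j <;> simp [Prod.fst_sum, Prod.snd_sum, Finset.sum_apply, Pi.single_apply]
  rw [hvec]
  simp only [map_add, map_sum, map_smul, smul_eq_mul]

/-- The first variation of the extended Type II action, after integration by parts. -/
lemma hasDerivAt_extendedAction {n : ℕ} (T : ℝ)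
    {h k : (Fin n → ℝ) × ℝ × (Fin n → ℝ) → ℝ} (hh : ContDiff ℝ 1 h) (hk : ContDiff ℝ 1 k)
    {q p : ℝ → Fin n → ℝ} {r s : ℝ → ℝ}
    (hq : ContDiff ℝ 1 q) (hp : ContDiff ℝ 1 p) (hr : ContDiff ℝ 1 r) (hs : ContDiff ℝ 1 s)
    {dq dp : ℝ → Fin n → ℝ} {dr ds : ℝ → ℝ}
    (hdq : ContDiff ℝ 1 dq) (hdp : ContDiff ℝ 1 dp) (hdr : ContDiff ℝ 1 dr)
    (hds : ContDiff ℝ 1 ds)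
    (hdq0 : dq 0 = 0) (hdr0 : dr 0 = 0) (hdpT : dp T = 0) (hdsT : ds T = 0) :
    HasDerivAt (fun ε : ℝ =>
      (∑ i, (p T + ε • dp T) i * (q T + ε • dq T) i) + (s T + ε * ds T) * (r T + ε * dr T) -
        ∫ τ in (0 : ℝ)..T,
          ((∑ i, (p τ + ε • dp τ) i * deriv (fun t => (q t + ε • dq t) i) τ)
            + (s τ + ε * ds τ) * deriv (fun t => r t + ε * dr t) τ
            - k (q τ + ε • dq τ, r τ + ε * dr τ, p τ + ε • dp τ)
              * (h (q τ + ε • dq τ, r τ + ε * dr τ, p τ + ε • dp τ) + (s τ + ε * ds τ))))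
      (∫ τ in (0 : ℝ)..T,
        ((∑ i, dq τ i * (deriv (fun t => p t i) τ
            + (k (q τ, r τ, p τ) * fderiv ℝ h (q τ, r τ, p τ) (Pi.single i 1, 0, 0)
              + fderiv ℝ k (q τ, r τ, p τ) (Pi.single i 1, 0, 0)
                * (h (q τ, r τ, p τ) + s τ))))
          + dr τ * (deriv s τ
            + (k (q τ, r τ, p τ) * fderiv ℝ h (q τ, r τ, p τ) (0, 1, 0)
              + fderiv ℝ k (q τ, r τ, p τ) (0, 1, 0) * (h (q τ, r τ, p τ) + s τ)))
          - (∑ i, dp τ i * (deriv (fun t => q t i) τ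
            - (k (q τ, r τ, p τ) * fderiv ℝ h (q τ, r τ, p τ) (0, 0, Pi.single i 1)
              + fderiv ℝ k (q τ, r τ, p τ) (0, 0, Pi.single i 1)
                * (h (q τ, r τ, p τ) + s τ))))
          - ds τ * (deriv r τ - k (q τ, r τ, p τ)))) 0 := by
  have hcomp : ∀ {y : ℝ → Fin n → ℝ}, ContDiff ℝ 1 y → ∀ i, ContDiff ℝ 1 fun t => y t i :=
    fun hy i => contDiff_pi.1 hy i
  have hder : ∀ {y : ℝ → ℝ}, ContDiff ℝ 1 y → ∀ t, HasDerivAt y (deriv y t) t :=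
    fun hy t => (hy.differentiable one_ne_zero t).hasDerivAt
  have hcont : ∀ {y : ℝ → ℝ}, ContDiff ℝ 1 y → Continuous (deriv y) :=
    fun hy => hy.continuous_deriv le_rfl
  have cq' := fun i => hcont (hcomp hq i)
  have cdq' := fun i => hcont (hcomp hdq i)
  have cp' := fun i => hcont (hcomp hp i)
  have cr' := hcont hr
  have cdr' := hcont hdr
  have cs' := hcont hs
  have cq := hq.continuous
  have cp := hp.continuous
  have cr := hr.continuous
  have cs := hs.continuous
  have cdq := hdq.continuous
  have cdp := hdp.continuous
  have cdr := hdr.continuous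
  have cds := hds.continuous
  have ch := hh.continuous
  have ck := hk.continuous
  have ch' := hh.continuous_fderiv one_ne_zero
  have ck' := hk.continuous_fderiv one_ne_zero
  have hvecderiv : ∀ ε τ i, deriv (fun t => (q t + ε • dq t) i) τ
      = deriv (fun t => q t i) τ + ε * deriv (fun t => dq t i) τ := fun ε τ i =>
    ((hder (hcomp hq i) τ).add ((hder (hcomp hdq i) τ).const_mul ε)).deriv
  have hscalderiv : ∀ ε τ, deriv (fun t => r t + ε * dr t) τ = deriv r τ + ε * deriv dr τ :=
    fun ε τ => ((hder hr τ).add ((hder hdr τ).const_mul ε)).deriv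
  simp only [hvecderiv, hscalderiv]
  set w : ℝ → ℝ → (Fin n → ℝ) × ℝ × (Fin n → ℝ) := fun ε τ =>
    (q τ + ε • dq τ, r τ + ε * dr τ, p τ + ε • dp τ) with hw
  have hwd : ∀ ε τ, HasDerivAt (fun e => w e τ) (dq τ, dr τ, dp τ) ε := by
    intro ε τ
    have hv : ∀ x y : Fin n → ℝ, HasDerivAt (fun e : ℝ => x + e • y) y ε := fun x y => by
      simpa using ((hasDerivAt_id ε).smul_const y).const_add x
    have h1 : HasDerivAt (fun e : ℝ => r τ + e * dr τ) (dr τ) ε := by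
      simpa using ((hasDerivAt_id ε).mul_const (dr τ)).const_add (r τ)
    exact (hv _ _).prodMk (h1.prodMk (hv _ _))
  have hlin : ∀ ε x y : ℝ, HasDerivAt (fun e : ℝ => x + e * y) y ε := fun ε x y => by
    simpa using ((hasDerivAt_id ε).mul_const y).const_add x
  have hbdry : HasDerivAt (fun ε : ℝ =>
      (∑ i, (p T + ε • dp T) i * (q T + ε • dq T) i) + (s T + ε * ds T) * (r T + ε * dr T))
      ((∑ i, p T i * dq T i) + s T * dr T) 0 := by
    simp only [hdpT, hdsT, Pi.add_apply, Pi.smul_apply, Pi.zero_apply, smul_eq_mul, add_zero,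
      mul_zero]
    exact (HasDerivAt.fun_sum fun i _ => (hlin 0 (q T i) (dq T i)).const_mul (p T i)).add
      ((hlin 0 (r T) (dr T)).const_mul (s T))
  have hint := hasDerivAt_intervalIntegral_of_continuous (a := 0) (b := T) (x₀ := 0)
    (F := fun ε τ =>
      (∑ i, (p τ + ε • dp τ) i * (deriv (fun t => q t i) τ + ε * deriv (fun t => dq t i) τ))
        + (s τ + ε * ds τ) * (deriv r τ + ε * deriv dr τ)
        - k (w ε τ) * (h (w ε τ) + (s τ + ε * ds τ)))
    (F' := fun ε τ =>
      (∑ i, (dp τ i * (deriv (fun t => q t i) τ + ε * deriv (fun t => dq t i) τ)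
          + (p τ i + ε * dp τ i) * deriv (fun t => dq t i) τ))
        + (ds τ * (deriv r τ + ε * deriv dr τ) + (s τ + ε * ds τ) * deriv dr τ)
        - (fderiv ℝ k (w ε τ) (dq τ, dr τ, dp τ) * (h (w ε τ) + (s τ + ε * ds τ))
          + k (w ε τ) * (fderiv ℝ h (w ε τ) (dq τ, dr τ, dp τ) + ds τ)))
    (fun ε => by simp only [hw, Pi.add_apply, Pi.smul_apply]; fun_prop)
    (by simp only [hw]; fun_prop)
    (fun ε τ => by
      have hkd := ((hk.differentiable one_ne_zero) (w ε τ)).hasFDerivAt.comp_hasDerivAt ε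
        (hwd ε τ)
      have hhd := ((hh.differentiable one_ne_zero) (w ε τ)).hasFDerivAt.comp_hasDerivAt ε
        (hwd ε τ)
      exact ((HasDerivAt.fun_sum fun i _ => (hlin ε (p τ i) (dp τ i)).mul (hlin ε _ _)).add
        ((hlin ε (s τ) (ds τ)).mul (hlin ε _ _))).sub
          (hkd.mul (hhd.add (hlin ε (s τ) (ds τ)))))
  refine (hbdry.sub hint).congr_deriv ?_
  have hparts : ∫ τ in (0 : ℝ)..T,
      ((∑ i, (deriv (fun t => p t i) τ * dq τ i + p τ i * deriv (fun t => dq t i) τ))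
        + (deriv s τ * dr τ + s τ * deriv dr τ)) = (∑ i, p T i * dq T i) + s T * dr T := by
    rw [intervalIntegral.integral_eq_sub_of_hasDerivAt
      (f := fun τ => (∑ i, p τ i * dq τ i) + s τ * dr τ)
      (fun τ _ => (HasDerivAt.fun_sum fun i _ =>
        (hder (hcomp hp i) τ).mul (hder (hcomp hdq i) τ)).add ((hder hs τ).mul (hder hdr τ)))
      (Continuous.intervalIntegrable (by fun_prop) _ _)]
    simp [hdq0, hdr0]
  rw [← hparts, ← intervalIntegral.integral_sub
    (Continuous.intervalIntegrable (by fun_prop) _ _)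
    (Continuous.intervalIntegrable (by simp only [hw]; fun_prop) _ _)]
  refine intervalIntegral.integral_congr fun τ _ => ?_
  have hw0 : w 0 τ = (q τ, r τ, p τ) := by simp [hw]
  simp only [hw0, zero_mul, add_zero]
  rw [clm_apply_prod_eq_sum (fderiv ℝ k _), clm_apply_prod_eq_sum (fderiv ℝ h _)]
  simp only [mul_add, mul_sub, add_mul, Finset.sum_add_distrib, Finset.sum_sub_distrib,
    Finset.sum_mul, Finset.mul_sum]
  simp only [mul_comm, mul_left_comm]
  ring

/-- A C¹ curve `(q,𝔮,p,𝔭) : [0,T̄] → ℝⁿ × ℝ × ℝⁿ × ℝ` makes the extended Type II action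
`𝔖 = p(T̄)ᵀq(T̄) + 𝔭(T̄)𝔮(T̄) − ∫₀^{T̄} { pᵀq' + 𝔭𝔮' − g(q,𝔮,p)[H(q,𝔮,p) + 𝔭] } dτ`
stationary with respect to all C¹ variations vanishing in position at `τ = 0` and in momentum
at `τ = T̄` if and only if it satisfies the extended Hamilton's equations of the Poincaré
transformed Hamiltonian:  `𝔮' = g`, `q' = g ∂H/∂p + (∂g/∂p)(H + 𝔭)`,
`p' = −g ∂H/∂q − (∂g/∂q)(H + 𝔭)`, `𝔭' = −g ∂H/∂𝔮 − (∂g/∂𝔮)(H + 𝔭)`. -/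
theorem poincare_variational_principle {n : ℕ} (T' : ℝ) (hT' : 0 < T')
    (H g : (Fin n → ℝ) → ℝ → (Fin n → ℝ) → ℝ)
    (hH : ContDiff ℝ 1 fun x : (Fin n → ℝ) × ℝ × (Fin n → ℝ) => H x.1 x.2.1 x.2.2)
    (hg : ContDiff ℝ 1 fun x : (Fin n → ℝ) × ℝ × (Fin n → ℝ) => g x.1 x.2.1 x.2.2)
    (S : (ℝ → Fin n → ℝ) → (ℝ → ℝ) → (ℝ → Fin n → ℝ) → (ℝ → ℝ) → ℝ)
    (hS : ∀ q 𝔮 p 𝔭, S q 𝔮 p 𝔭 =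
      (∑ i, p T' i * q T' i) + 𝔭 T' * 𝔮 T' -
        ∫ τ in (0 : ℝ)..T',
          ((∑ i, p τ i * deriv (fun s => q s i) τ) + 𝔭 τ * deriv 𝔮 τ
            - g (q τ) (𝔮 τ) (p τ) * (H (q τ) (𝔮 τ) (p τ) + 𝔭 τ)))
    (q p : ℝ → Fin n → ℝ) (𝔮 𝔭 : ℝ → ℝ)
    (hq : ContDiff ℝ 1 q) (hp : ContDiff ℝ 1 p)
    (h𝔮 : ContDiff ℝ 1 𝔮) (h𝔭 : ContDiff ℝ 1 𝔭) :
    (∀ (δq δp : ℝ → Fin n → ℝ) (δ𝔮 δ𝔭 : ℝ → ℝ),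
      ContDiff ℝ 1 δq → ContDiff ℝ 1 δp → ContDiff ℝ 1 δ𝔮 → ContDiff ℝ 1 δ𝔭 →
      δq 0 = 0 → δ𝔮 0 = 0 → δp T' = 0 → δ𝔭 T' = 0 →
      HasDerivAt (fun ε : ℝ =>
        S (fun τ => q τ + ε • δq τ) (fun τ => 𝔮 τ + ε * δ𝔮 τ)
          (fun τ => p τ + ε • δp τ) (fun τ => 𝔭 τ + ε * δ𝔭 τ)) 0 0)
    ↔ (∀ τ ∈ Set.Icc (0 : ℝ) T',
        HasDerivAt 𝔮 (g (q τ) (𝔮 τ) (p τ)) τ ∧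
        (∀ i, HasDerivAt (fun s => q s i)
          (g (q τ) (𝔮 τ) (p τ) *
              fderiv ℝ (fun c => H (q τ) (𝔮 τ) c) (p τ) (Pi.single i 1)
            + fderiv ℝ (fun c => g (q τ) (𝔮 τ) c) (p τ) (Pi.single i 1)
              * (H (q τ) (𝔮 τ) (p τ) + 𝔭 τ)) τ) ∧
        (∀ i, HasDerivAt (fun s => p s i)
          (-(g (q τ) (𝔮 τ) (p τ) *
              fderiv ℝ (fun a => H a (𝔮 τ) (p τ)) (q τ) (Pi.single i 1))
            - fderiv ℝ (fun a => g a (𝔮 τ) (p τ)) (q τ) (Pi.single i 1)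
              * (H (q τ) (𝔮 τ) (p τ) + 𝔭 τ)) τ) ∧
        HasDerivAt 𝔭
          (-(g (q τ) (𝔮 τ) (p τ) * deriv (fun b => H (q τ) b (p τ)) (𝔮 τ))
            - deriv (fun b => g (q τ) b (p τ)) (𝔮 τ)
              * (H (q τ) (𝔮 τ) (p τ) + 𝔭 τ)) τ) := by
  simp only [fderiv_fst_eq hH, fderiv_fst_eq hg, deriv_snd_eq hH, deriv_snd_eq hg,
    fderiv_trd_eq hH, fderiv_trd_eq hg, hS]
  have hvar := @hasDerivAt_extendedAction n T' _ _ hH hg q p 𝔮 𝔭 hq hp h𝔮 h𝔭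
  set h := fun x : (Fin n → ℝ) × ℝ × (Fin n → ℝ) => H x.1 x.2.1 x.2.2 with hh
  set k := fun x : (Fin n → ℝ) × ℝ × (Fin n → ℝ) => g x.1 x.2.1 x.2.2 with hk
  have cq := hq.continuous
  have cp := hp.continuous
  have c𝔮 := h𝔮.continuous
  have c𝔭 := h𝔭.continuous
  have ch := hH.continuous
  have ck := hg.continuous
  have ch' := hH.continuous_fderiv one_ne_zero
  have ck' := hg.continuous_fderiv one_ne_zero
  have cq' := fun i => (contDiff_pi.1 hq i).continuous_deriv le_rfl
  have cp' := fun i => (contDiff_pi.1 hp i).continuous_deriv le_rfl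
  have c𝔮' := h𝔮.continuous_deriv le_rfl
  have c𝔭' := h𝔭.continuous_deriv le_rfl
  have hder : ∀ {y : ℝ → ℝ}, ContDiff ℝ 1 y → ∀ {t d : ℝ}, deriv y t = d → HasDerivAt y d t :=
    fun hy t _ hd => hd ▸ (hy.differentiable one_ne_zero t).hasDerivAt
  have hsingle : ∀ {φ : ℝ → ℝ}, ContDiff ℝ 1 φ → ∀ i : Fin n,
      ContDiff ℝ 1 fun t => (Pi.single i (φ t) : Fin n → ℝ) := fun hφ i =>
    (ContinuousLinearMap.single ℝ (fun _ : Fin n => ℝ) i).contDiff.comp hφ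
  have h0 : ContDiff ℝ 1 fun _ : ℝ => (0 : Fin n → ℝ) := contDiff_const
  have h0' : ContDiff ℝ 1 fun _ : ℝ => (0 : ℝ) := contDiff_const
  constructor
  · intro hst
    have hzero := fun δq δp δ𝔮 δ𝔭 h1 h2 h3 h4 h5 h6 h7 h8 =>
      (hvar (dq := δq) (dp := δp) (dr := δ𝔮) (ds := δ𝔭) h1 h2 h3 h4 h5 h6 h7 h8).unique
        (hst δq δp δ𝔮 δ𝔭 h1 h2 h3 h4 h5 h6 h7 h8)
    have e𝔮 := eqOn_zero_of_intervalIntegral_mul_eq_zero hT'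
      (f := fun τ => deriv 𝔮 τ - k (q τ, 𝔮 τ, p τ)) (by fun_prop) fun φ hφ _ hφT => by
        simpa using hzero _ _ _ φ h0 h0 h0' hφ rfl rfl rfl hφT
    have e𝔭 := eqOn_zero_of_intervalIntegral_mul_eq_zero hT'
      (f := fun τ => deriv 𝔭 τ
            + (k (q τ, 𝔮 τ, p τ) * fderiv ℝ h (q τ, 𝔮 τ, p τ) (0, 1, 0)
              + fderiv ℝ k (q τ, 𝔮 τ, p τ) (0, 1, 0) * (h (q τ, 𝔮 τ, p τ) + 𝔭 τ)))
      (by fun_prop) fun φ hφ hφ0 _ => by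
        simpa using hzero _ _ φ _ h0 h0 hφ h0' rfl hφ0 rfl rfl
    have eq := fun i => eqOn_zero_of_intervalIntegral_mul_eq_zero hT'
      (f := fun τ => deriv (fun t => q t i) τ
            - (k (q τ, 𝔮 τ, p τ) * fderiv ℝ h (q τ, 𝔮 τ, p τ) (0, 0, Pi.single i 1)
              + fderiv ℝ k (q τ, 𝔮 τ, p τ) (0, 0, Pi.single i 1)
                * (h (q τ, 𝔮 τ, p τ) + 𝔭 τ)))
      (by fun_prop) fun φ hφ _ hφT => by
        simpa [Pi.single_apply] using
          hzero _ _ _ _ h0 (hsingle hφ i) h0' h0' rfl rfl (by simp [hφT]) rfl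
    have ep := fun i => eqOn_zero_of_intervalIntegral_mul_eq_zero hT'
      (f := fun τ => deriv (fun t => p t i) τ
            + (k (q τ, 𝔮 τ, p τ) * fderiv ℝ h (q τ, 𝔮 τ, p τ) (Pi.single i 1, 0, 0)
              + fderiv ℝ k (q τ, 𝔮 τ, p τ) (Pi.single i 1, 0, 0)
                * (h (q τ, 𝔮 τ, p τ) + 𝔭 τ)))
      (by fun_prop) fun φ hφ hφ0 _ => by
        simpa [Pi.single_apply] using
          hzero _ _ _ _ (hsingle hφ i) h0 h0' h0' (by simp [hφ0]) rfl rfl rfl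
    intro τ hτ
    refine ⟨hder h𝔮 ?_, fun i => hder (contDiff_pi.1 hq i) ?_,
      fun i => hder (contDiff_pi.1 hp i) ?_, hder h𝔭 ?_⟩
    · linarith [e𝔮 τ hτ]
    · linarith [eq i τ hτ]
    · linarith [ep i τ hτ]
    · linarith [e𝔭 τ hτ]
  · intro heq δq δp δ𝔮 δ𝔭 h1 h2 h3 h4 h5 h6 h7 h8
    refine (hvar h1 h2 h3 h4 h5 h6 h7 h8).congr_deriv ?_
    refine (intervalIntegral.integral_congr (g := fun _ => (0 : ℝ)) fun τ hτ => ?_).trans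
      intervalIntegral.integral_zero
    rw [uIcc_of_le hT'.le] at hτ
    obtain ⟨e𝔮, eq, ep, e𝔭⟩ := heq τ hτ
    simp only [e𝔮.deriv, e𝔭.deriv, fun i => (eq i).deriv, fun i => (ep i).deriv, hk, hh]
    ring_nf
end

section
/- Let L_d : ℝⁿ × ℝ × ℝⁿ × ℝ → ℝ be C¹ with arguments (q₀,𝔮₀,q₁,𝔮₁), let g : ℝ → ℝ be C¹, let 0 = τ₀ < τ₁ < ⋯ < τ_N = 𝒯 be a partition, and consider a discrete curve {(q_k,𝔮_k,λ_k)}_{k=0}^N in ℝⁿ × ℝ × ℝ with 𝔮_{k+1} ≠ 𝔮_k for all k. Define the discrete action 𝔖_d = Σ_{k=0}^{N−1} [ L_d(q_k,𝔮_k,q_{k+1},𝔮_{k+1}) − λ_k (𝔮_{k+1}−𝔮_k)/(τ_{k+1}−τ_k) + λ_k g(𝔮_k) ] · (𝔮_{k+1}−𝔮_k)/(τ_{k+1}−τ_k). Then the partial derivatives of 𝔖_d with respect to all interior variables q_k and 𝔮_k (1 ≤ k ≤ N−1) and with respect to all multipliers λ_k (0 ≤ k ≤ N−1) vanish if and only if: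 (i) 𝔮_{k+1} = 𝔮_k + (τ_{k+1}−τ_k) g(𝔮_k) for 0 ≤ k ≤ N−1; (ii) ((𝔮_{k+1}−𝔮_k)/(τ_{k+1}−τ_k)) D₁L_d(q_k,𝔮_k,q_{k+1},𝔮_{k+1}) + ((𝔮_k−𝔮_{k−1})/(τ_k−τ_{k−1})) D₃L_d(q_{k−1},𝔮_{k−1},q_k,𝔮_k) = 0 for 1 ≤ k ≤ N−1; and (iii) [D₂L_{d_k} + λ_k/(τ_{k+1}−τ_k) + λ_k g'(𝔮_k)]·(𝔮_{k+1}−𝔮_k)/(τ_{k+1}−τ_k) − (1/(τ_{k+1}−τ_k))[L_{d_k} − λ_k(𝔮_{k+1}−𝔮_k)/(τ_{k+1}−τ_k) + λ_k g(𝔮_k)] + [D₄L_{d_{k−1}} − λ_{k−1}/(τ_k−τ_{k−1})]·(𝔮_k−𝔮_{k−1})/(τ_k−τ_{k−1}) + (1/(τ_k−τ_{k−1}))[L_{d_{k−1}} − λ_{k−1}(𝔮_k−𝔮_{k−1})/(τ_k−τ_{k−1}) + λ_{k−1} g(𝔮_{k−1})] = 0 for 1 ≤ k ≤ N−1, where L_{d_k}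 denotes L_d(q_k,𝔮_k,q_{k+1},𝔮_{k+1}) and D_i denotes the partial derivative with respect to the i-th argument. -/
/-- Differentiating a two-point chain sum in one interior node only sees the two adjacent terms. -/
lemma hasDerivAt_sum_chain_update {X : Type*} {N m : ℕ} (hm : m + 1 < N) (F : ℕ → X → X → ℝ)
    (x : ℕ → X) (c : ℝ → X) {a b t : ℝ}
    (ha : HasDerivAt (fun ε => F (m + 1) (c ε) (x (m + 1 + 1))) a t)
    (hb : HasDerivAt (fun ε => F m (x m) (c ε)) b t) :
    HasDerivAt (fun ε => ∑ j ∈ Finset.range N,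
      F j (Function.update x (m + 1) (c ε) j) (Function.update x (m + 1) (c ε) (j + 1)))
      (a + b) t := by
  have key : ∀ j ∈ Finset.range N, HasDerivAt
      (fun ε => F j (Function.update x (m + 1) (c ε) j) (Function.update x (m + 1) (c ε) (j + 1)))
      ((if j = m + 1 then a else 0) + (if j = m then b else 0)) t := by
    intro j _
    by_cases h₁ : j = m + 1
    · subst h₁
      simpa using ha
    · by_cases h₂ : j = m
      · subst h₂
        simpa using hb
      · simpa [Function.update_of_ne, h₁, h₂] using hasDerivAt_const t (F j (x j) (x (j + 1)))
  have hsum := HasDerivAt.fun_sum key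
  rwa [Finset.sum_add_distrib, Finset.sum_ite_eq', Finset.sum_ite_eq',
    if_pos (Finset.mem_range.2 hm), if_pos (Finset.mem_range.2 (by omega))] at hsum

/-- Differentiating a sum in one node only sees the term attached to that node. -/
lemma hasDerivAt_sum_update {X : Type*} {N k : ℕ} (hk : k < N) (F : ℕ → X → ℝ)
    (x : ℕ → X) (c : ℝ → X) {a t : ℝ} (ha : HasDerivAt (fun ε => F k (c ε)) a t) :
    HasDerivAt (fun ε => ∑ j ∈ Finset.range N, F j (Function.update x k (c ε) j)) a t := by
  have key : ∀ j ∈ Finset.range N, HasDerivAt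
      (fun ε => F j (Function.update x k (c ε) j)) (if j = k then a else 0) t := by
    intro j _
    by_cases h : j = k
    · subst h
      simpa using ha
    · simpa [Function.update_of_ne, h] using hasDerivAt_const t (F j (x j))
  have hsum := HasDerivAt.fun_sum key
  rwa [Finset.sum_ite_eq', if_pos (Finset.mem_range.2 hk)] at hsum

lemma HasDerivAt.hasDerivAt_zero_iff {f : ℝ → ℝ} {d t : ℝ} (h : HasDerivAt f d t) :
    HasDerivAt f 0 t ↔ d = 0 :=
  ⟨fun h₀ => h.unique h₀, fun hd => hd ▸ h⟩

/-- The chain rule along a line, for a real function on a normed space. -/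
lemma DifferentiableAt.hasDerivAt_add_smul {E : Type*} [NormedAddCommGroup E] [NormedSpace ℝ E]
    {f : E → ℝ} {x : E} (hf : DifferentiableAt ℝ f x) (v : E) :
    HasDerivAt (fun ε : ℝ => f (x + ε • v)) (fderiv ℝ f x v) 0 := by
  have hline : HasDerivAt (fun ε : ℝ => x + ε • v) v 0 := by
    simpa using ((hasDerivAt_id (0 : ℝ)).smul_const v).const_add x
  exact hf.hasFDerivAt.comp_hasDerivAt_of_eq 0 hline (by simp)

lemma DifferentiableAt.hasDerivAt_const_add {f : ℝ → ℝ} {x : ℝ} (hf : DifferentiableAt ℝ f x) :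
    HasDerivAt (fun ε : ℝ => f (x + ε)) (deriv f x) 0 := by
  simpa using hf.hasDerivAt_add_smul 1

/-- First time-adaptive discrete framework: the discrete Hamilton's variational principle
(vanishing of all partial derivatives of the discrete action
`𝔖_d = Σ_k [L_d(q_k,𝔮_k,q_{k+1},𝔮_{k+1}) − λ_k (𝔮_{k+1}−𝔮_k)/(τ_{k+1}−τ_k) + λ_k g(𝔮_k)]
· (𝔮_{k+1}−𝔮_k)/(τ_{k+1}−τ_k)` with respect to interior `q_k`, `𝔮_k` and all `λ_k`) is
equivalent to the discrete extended Euler–Lagrange equations (i)–(iii). -/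
theorem adaptive_discrete_EL_first_framework {n N : ℕ} (hN : 0 < N) (𝒯 : ℝ)
    (Ld : (Fin n → ℝ) → ℝ → (Fin n → ℝ) → ℝ → ℝ)
    (hLd : ContDiff ℝ 1 fun x : (Fin n → ℝ) × ℝ × (Fin n → ℝ) × ℝ =>
      Ld x.1 x.2.1 x.2.2.1 x.2.2.2)
    (g : ℝ → ℝ) (hg : ContDiff ℝ 1 g)
    (τ : ℕ → ℝ) (hτ0 : τ 0 = 0) (hτN : τ N = 𝒯) (hτmono : ∀ k < N, τ k < τ (k + 1))
    (q : ℕ → Fin n → ℝ) (𝔮 lam : ℕ → ℝ)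
    (h𝔮ne : ∀ k < N, 𝔮 (k + 1) ≠ 𝔮 k)
    (Sd : (ℕ → Fin n → ℝ) → (ℕ → ℝ) → (ℕ → ℝ) → ℝ)
    (hSd : ∀ Q Qf Lam, Sd Q Qf Lam = ∑ k ∈ Finset.range N,
      (Ld (Q k) (Qf k) (Q (k + 1)) (Qf (k + 1))
        - Lam k * ((Qf (k + 1) - Qf k) / (τ (k + 1) - τ k))
        + Lam k * g (Qf k)) * ((Qf (k + 1) - Qf k) / (τ (k + 1) - τ k))) :
    ((∀ k, 1 ≤ k → k < N → ∀ i : Fin n,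
        HasDerivAt (fun ε : ℝ =>
          Sd (Function.update q k (q k + ε • (Pi.single i 1 : Fin n → ℝ))) 𝔮 lam) 0 0) ∧
     (∀ k, 1 ≤ k → k < N →
        HasDerivAt (fun ε : ℝ => Sd q (Function.update 𝔮 k (𝔮 k + ε)) lam) 0 0) ∧
     (∀ k, k < N →
        HasDerivAt (fun ε : ℝ => Sd q 𝔮 (Function.update lam k (lam k + ε))) 0 0))
    ↔
    ((∀ k, k < N → 𝔮 (k + 1) = 𝔮 k + (τ (k + 1) - τ k) * g (𝔮 k)) ∧
     (∀ k, 1 ≤ k → k < N → ∀ i : Fin n,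
        ((𝔮 (k + 1) - 𝔮 k) / (τ (k + 1) - τ k)) *
          fderiv ℝ (fun a => Ld a (𝔮 k) (q (k + 1)) (𝔮 (k + 1))) (q k) (Pi.single i 1)
        + ((𝔮 k - 𝔮 (k - 1)) / (τ k - τ (k - 1))) *
          fderiv ℝ (fun c => Ld (q (k - 1)) (𝔮 (k - 1)) c (𝔮 k)) (q k) (Pi.single i 1)
        = 0) ∧
     (∀ k, 1 ≤ k → k < N →
        (deriv (fun b => Ld (q k) b (q (k + 1)) (𝔮 (k + 1))) (𝔮 k)
            + lam k * (1 / (τ (k + 1) - τ k)) + lam k * deriv g (𝔮 k))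
          * ((𝔮 (k + 1) - 𝔮 k) / (τ (k + 1) - τ k))
        - (1 / (τ (k + 1) - τ k)) *
          (Ld (q k) (𝔮 k) (q (k + 1)) (𝔮 (k + 1))
            - lam k * ((𝔮 (k + 1) - 𝔮 k) / (τ (k + 1) - τ k)) + lam k * g (𝔮 k))
        + (deriv (fun e => Ld (q (k - 1)) (𝔮 (k - 1)) (q k) e) (𝔮 k)
            - lam (k - 1) * (1 / (τ k - τ (k - 1))))
          * ((𝔮 k - 𝔮 (k - 1)) / (τ k - τ (k - 1)))
        + (1 / (τ k - τ (k - 1))) *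
          (Ld (q (k - 1)) (𝔮 (k - 1)) (q k) (𝔮 k)
            - lam (k - 1) * ((𝔮 k - 𝔮 (k - 1)) / (τ k - τ (k - 1)))
            + lam (k - 1) * g (𝔮 (k - 1)))
        = 0)) := by
  have hL := hLd.differentiable one_ne_zero
  have hL₁ : ∀ a b c e, DifferentiableAt ℝ (fun a => Ld a b c e) a := fun a b c e =>
    (hL (a, b, c, e)).comp (f := fun a => (a, b, c, e)) a (by fun_prop)
  have hL₂ : ∀ a b c e, DifferentiableAt ℝ (fun b => Ld a b c e) b := fun a b c e =>
    (hL (a, b, c, e)).comp (f := fun b => (a, b, c, e)) b (by fun_prop)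
  have hL₃ : ∀ a b c e, DifferentiableAt ℝ (fun c => Ld a b c e) c := fun a b c e =>
    (hL (a, b, c, e)).comp (f := fun c => (a, b, c, e)) c (by fun_prop)
  have hL₄ : ∀ a b c e, DifferentiableAt ℝ (fun e => Ld a b c e) e := fun a b c e =>
    (hL (a, b, c, e)).comp (f := fun e => (a, b, c, e)) e (by fun_prop)
  have hgd := hg.differentiable one_ne_zero
  have hid : ∀ x : ℝ, HasDerivAt (fun ε : ℝ => x + ε) 1 0 := fun x =>
    (hasDerivAt_id (0 : ℝ)).const_add x
  simp only [hSd]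
  rw [← and_assoc, and_comm]
  refine and_congr (forall_congr' fun k => forall_congr' fun hk => ?_)
    (and_congr (forall_congr' fun k => forall_congr' fun hk1 => forall_congr' fun hk =>
      forall_congr' fun i => ?_)
      (forall_congr' fun k => forall_congr' fun hk1 => forall_congr' fun hk => ?_))
  · have hτ : τ (k + 1) - τ k ≠ 0 := (sub_pos.2 (hτmono k hk)).ne'
    have hq : 𝔮 (k + 1) - 𝔮 k ≠ 0 := sub_ne_zero.2 (h𝔮ne k hk)
    rw [(hasDerivAt_sum_update hk (fun j l =>
      (Ld (q j) (𝔮 j) (q (j + 1)) (𝔮 (j + 1)) - l * ((𝔮 (j + 1) - 𝔮 j) / (τ (j + 1) - τ j))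
        + l * g (𝔮 j)) * ((𝔮 (j + 1) - 𝔮 j) / (τ (j + 1) - τ j))) lam (fun ε => lam k + ε)
      (((((hid (lam k)).mul_const _).const_sub _).add
        ((hid (lam k)).mul_const _)).mul_const _)).hasDerivAt_zero_iff,
      mul_eq_zero, or_iff_left (div_ne_zero hq hτ)]
    field_simp
    constructor <;> intro h <;> linarith
  · obtain ⟨m, rfl⟩ := Nat.exists_eq_add_of_le' hk1
    rw [(hasDerivAt_sum_chain_update hk (fun j x y =>
      (Ld x (𝔮 j) y (𝔮 (j + 1)) - lam j * ((𝔮 (j + 1) - 𝔮 j) / (τ (j + 1) - τ j))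
        + lam j * g (𝔮 j)) * ((𝔮 (j + 1) - 𝔮 j) / (τ (j + 1) - τ j))) q
      (fun ε => q (m + 1) + ε • (Pi.single i 1 : Fin n → ℝ))
      (((((hL₁ _ _ _ _).hasDerivAt_add_smul _).sub_const _).add_const _).mul_const _)
      (((((hL₃ _ _ _ _).hasDerivAt_add_smul _).sub_const _).add_const _).mul_const
        _)).hasDerivAt_zero_iff]
    simp only [Nat.add_sub_cancel, mul_comm]
  · obtain ⟨m, rfl⟩ := Nat.exists_eq_add_of_le' hk1
    have hfst := ((hid (𝔮 (m + 1))).const_sub (𝔮 (m + 1 + 1))).div_const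
      (τ (m + 1 + 1) - τ (m + 1))
    have hsnd := ((hid (𝔮 (m + 1))).sub_const (𝔮 m)).div_const (τ (m + 1) - τ m)
    rw [(hasDerivAt_sum_chain_update hk (fun j x y =>
      (Ld (q j) x (q (j + 1)) y - lam j * ((y - x) / (τ (j + 1) - τ j))
        + lam j * g x) * ((y - x) / (τ (j + 1) - τ j))) 𝔮
      (fun ε => 𝔮 (m + 1) + ε)
      (((((hL₂ _ _ _ _).hasDerivAt_const_add).sub (hfst.const_mul _)).add
        ((hgd _).hasDerivAt_const_add.const_mul _)).mul hfst)
      (((((hL₄ _ _ _ _).hasDerivAt_const_add).sub (hsnd.const_mul _)).add_const _).mul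
        hsnd)).hasDerivAt_zero_iff]
    simp only [Nat.add_sub_cancel, Pi.add_apply, Pi.sub_apply, add_zero]
    refine Eq.congr ?_ rfl
    ring
end

section
/- Let f : ℝ^d → ℝ be C¹, let C > 0 and p, p̊ > 0, and let x : (0,∞) → ℝ^d be a C² curve satisfying the p-Bregman Euler–Lagrange equation ẍ(t) + ((p+1)/t) ẋ(t) + C p² t^{p−2} ∇f(x(t)) = 0 for all t > 0. Then the time-rescaled curve y : (0,∞) → ℝ^d defined by y(t) = x(t^{p̊/p}) satisfies the p̊-Bregman Euler–Lagrange equation ÿ(t) + ((p̊+1)/t) ẏ(t) + C p̊² t^{p̊−2} ∇f(y(t)) = 0 for all t > 0; that is, the family of Bregman Euler–Lagrange equations indexed by p is closed under time rescaling. -/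
section RpowReparametrization

variable {E : Type*} [NormedAddCommGroup E] [NormedSpace ℝ E] {x : ℝ → E} {a t : ℝ}

theorem hasDerivAt_comp_rpow (ht : 0 < t) (hx : DifferentiableAt ℝ x (t ^ a)) :
    HasDerivAt (fun s => x (s ^ a)) ((a * t ^ (a - 1)) • deriv x (t ^ a)) t :=
  hx.hasDerivAt.scomp t (Real.hasDerivAt_rpow_const (Or.inl ht.ne'))

theorem deriv_deriv_comp_rpow (ht : 0 < t) (hx : ∀ s > 0, DifferentiableAt ℝ x s)
    (hx' : DifferentiableAt ℝ (deriv x) (t ^ a)) :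
    deriv (deriv fun s => x (s ^ a)) t =
      (a * t ^ (a - 1)) ^ 2 • deriv (deriv x) (t ^ a)
        + (a * (a - 1) * t ^ (a - 2)) • deriv x (t ^ a) := by
  have hderiv : deriv (fun s => x (s ^ a)) =ᶠ[nhds t]
      fun s => (a * s ^ (a - 1)) • deriv x (s ^ a) := by
    filter_upwards [lt_mem_nhds ht] with s hs
    exact (hasDerivAt_comp_rpow hs (hx _ (Real.rpow_pos_of_pos hs a))).deriv
  have hcoeff : HasDerivAt (fun s : ℝ => a * s ^ (a - 1)) (a * ((a - 1) * t ^ (a - 1 - 1))) t :=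
    (Real.hasDerivAt_rpow_const (Or.inl ht.ne')).const_mul a
  rw [hderiv.deriv_eq, (hcoeff.fun_smul (hasDerivAt_comp_rpow ht hx')).deriv, smul_smul,
    show a - 1 - 1 = a - 2 by ring, pow_two, mul_assoc a (a - 1)]

end RpowReparametrization

/-- If a C² curve `x : (0,∞) → ℝ^d` satisfies the `p`-Bregman Euler–Lagrange equation
`ẍ(t) + ((p+1)/t) ẋ(t) + C p² t^{p−2} ∇f(x(t)) = 0` for all `t > 0`, then the time-rescaled
curve `y(t) = x(t^{p̊/p})` satisfies the `p̊`-Bregman Euler–Lagrange equation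
`ÿ(t) + ((p̊+1)/t) ẏ(t) + C p̊² t^{p̊−2} ∇f(y(t)) = 0` for all `t > 0`. -/
theorem bregman_time_rescaling {d : ℕ}
    (f : EuclideanSpace ℝ (Fin d) → ℝ) (hf : ContDiff ℝ 1 f)
    (C p p' : ℝ) (hC : 0 < C) (hp : 0 < p) (hp' : 0 < p')
    (x : ℝ → EuclideanSpace ℝ (Fin d)) (hx : ContDiffOn ℝ 2 x (Set.Ioi 0))
    (hODE : ∀ t > (0 : ℝ),
      deriv (deriv x) t + ((p + 1) / t) • deriv x t
        + (C * p ^ 2 * t ^ (p - 2)) • gradient f (x t) = 0)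
    (y : ℝ → EuclideanSpace ℝ (Fin d)) (hy : ∀ t, y t = x (t ^ (p' / p))) :
    ∀ t > (0 : ℝ),
      deriv (deriv y) t + ((p' + 1) / t) • deriv y t
        + (C * p' ^ 2 * t ^ (p' - 2)) • gradient f (y t) = 0 := by
  intro t ht
  obtain ⟨a, ha⟩ : ∃ a, a = p' / p := ⟨_, rfl⟩
  obtain rfl : p' = a * p := by rw [ha, div_mul_cancel₀ _ hp.ne']
  obtain rfl : y = fun t => x (t ^ a) := by
    funext t
    rw [hy, ← ha]
  have hdiff : ∀ s > 0, DifferentiableAt ℝ x s := fun s hs =>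
    (hx.differentiableOn two_ne_zero).differentiableAt (Ioi_mem_nhds hs)
  have hdiff' : ∀ s > 0, DifferentiableAt ℝ (deriv x) s := fun s hs =>
    ((hx.deriv_of_isOpen (m := 1) isOpen_Ioi (by norm_num)).differentiableOn
      one_ne_zero).differentiableAt (Ioi_mem_nhds hs)
  have hta : 0 < t ^ a := Real.rpow_pos_of_pos ht a
  rw [deriv_deriv_comp_rpow ht hdiff (hdiff' _ hta), (hasDerivAt_comp_rpow ht (hdiff _ hta)).deriv]
  have hpow_one : t ^ (a - 1) = t ^ a / t := by rw [Real.rpow_sub ht, Real.rpow_one]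
  have hpow_two : t ^ (a - 2) = t ^ a / t ^ 2 := by rw [Real.rpow_sub ht, Real.rpow_two]
  have hpow_mul : t ^ (a * p - 2) = (t ^ a) ^ p / t ^ 2 := by
    rw [Real.rpow_sub ht, Real.rpow_two, Real.rpow_mul ht.le]
  have hscaled := congrArg (fun v => (a * t ^ (a - 1)) ^ 2 • v) (hODE (t ^ a) hta)
  simp only [smul_zero] at hscaled
  rw [← hscaled, hpow_one, hpow_two, hpow_mul, Real.rpow_sub hta, Real.rpow_two]
  match_scalars <;> field_simp
  ring
end
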